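/- Let i ≠ j be indices with M i j = 0 (an ∞-edge). Then for every vector v ∈ ℝ^n that is not fixed by both σ_i and σ_j (equivalently, B(v, α_i) ≠ 0 or B(v, α_j) ≠ 0), the ℓ²-norms of the iterates diverge: ‖(σ_i σ_j)^k (v)‖ → ∞ as k → ∞. -/

import Mathlib

open scoped BigOperators

/-- The simple root `α_i`, the `i`-th standard basis vector of Euclidean space `ℝ^n`. -/
noncomputable def simpleRootE {n : ℕ} (i : Fin n) : EuclideanSpace ℝ (Fin n) :=
  EuclideanSpace.single i 1

/-- The symmetric bilinear form `B` associated to the Coxeter matrix `M`, determined by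
`B(α_i, α_j) = -cos (π / M i j)` when `M i j ≠ 0` and `B(α_i, α_j) = -1` when `M i j = 0`
(the label `∞`). -/
noncomputable def bformE {n : ℕ} (M : CoxeterMatrix (Fin n))
    (u v : EuclideanSpace ℝ (Fin n)) : ℝ :=
  ∑ i, ∑ j, u i * (if M i j = 0 then -1 else -Real.cos (Real.pi / (M i j))) * v j

/-- The simple reflection `σ_i(v) = v - 2 B(v, α_i) α_i`. -/
noncomputable def simpleReflE {n : ℕ} (M : CoxeterMatrix (Fin n)) (i : Fin n)
    (v : EuclideanSpace ℝ (Fin n)) : EuclideanSpace ℝ (Fin n) :=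
  v - (2 * bformE M v (simpleRootE i)) • simpleRootE i

theorem bformE_sub_smul {n : ℕ} (M : CoxeterMatrix (Fin n)) (u w x : EuclideanSpace ℝ (Fin n))
    (r : ℝ) : bformE M (u - r • w) x = bformE M u x - r * bformE M w x := by
  simp only [bformE, Finset.mul_sum, ← Finset.sum_sub_distrib]
  refine Finset.sum_congr rfl fun p _ => Finset.sum_congr rfl fun q _ => ?_
  simp only [PiLp.sub_apply, PiLp.smul_apply, smul_eq_mul]
  ring

theorem bformE_simpleRootE_simpleRootE {n : ℕ} (M : CoxeterMatrix (Fin n)) (i j : Fin n) :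
    bformE M (simpleRootE i) (simpleRootE j) =
      if M i j = 0 then -1 else -Real.cos (Real.pi / (M i j)) := by
  rw [bformE, Finset.sum_eq_single i]
  · simp [simpleRootE]
  · intro x _ hx
    simp [simpleRootE, hx]
  · simp

theorem bformE_simpleRootE_self {n : ℕ} (M : CoxeterMatrix (Fin n)) (i : Fin n) :
    bformE M (simpleRootE i) (simpleRootE i) = 1 := by
  simp [bformE_simpleRootE_simpleRootE]

/-- The pairings with `α_i` and `α_j`, and the `j`-th coordinate, of the iterates of `σ_i σ_j`
along an `∞`-edge. -/
theorem iterate_simpleReflE_of_eq_zero {n : ℕ} (M : CoxeterMatrix (Fin n)) {i j : Fin n}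
    (hij : i ≠ j) (hMij : M i j = 0) (v : EuclideanSpace ℝ (Fin n)) (k : ℕ) :
    let a := bformE M v (simpleRootE i)
    let b := bformE M v (simpleRootE j)
    let w := (fun u => simpleReflE M i (simpleReflE M j u))^[k] v
    bformE M w (simpleRootE i) = a - 2 * k * (a + b) ∧
      bformE M w (simpleRootE j) = b + 2 * k * (a + b) ∧
      w j = v j - 2 * k * b - 2 * (a + b) * (k * (k - 1)) := by
  have hMji : M j i = 0 := by rw [M.symmetric, hMij]
  have hBij : bformE M (simpleRootE i) (simpleRootE j) = -1 := by
    rw [bformE_simpleRootE_simpleRootE, if_pos hMij]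
  have hBji : bformE M (simpleRootE j) (simpleRootE i) = -1 := by
    rw [bformE_simpleRootE_simpleRootE, if_pos hMji]
  intro a b
  induction k with
  | zero => simp [a, b]
  | succ k ih =>
    obtain ⟨hi, hj, hc⟩ := ih
    rw [Function.iterate_succ_apply']
    generalize (fun u => simpleReflE M i (simpleReflE M j u))^[k] v = w at hi hj hc
    refine ⟨?_, ?_, ?_⟩
    · simp only [simpleReflE, bformE_sub_smul, bformE_simpleRootE_self, hBji, hi, hj]
      push_cast
      ring
    · simp only [simpleReflE, bformE_sub_smul, bformE_simpleRootE_self, hBij, hBji, hi, hj]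
      push_cast
      ring
    · have hrj : (simpleRootE j : EuclideanSpace ℝ (Fin n)) j = 1 := by simp [simpleRootE]
      have hri : (simpleRootE i : EuclideanSpace ℝ (Fin n)) j = 0 := by
        simp [simpleRootE, hij.symm]
      simp only [simpleReflE, PiLp.sub_apply, PiLp.smul_apply, smul_eq_mul, hrj, hri, hj, hc]
      push_cast
      ring

open Polynomial in
theorem tendsto_abs_quadratic_atTop {p q r : ℝ} (h : p ≠ 0 ∨ q ≠ 0) :
    Filter.Tendsto (fun x : ℝ => |p * x ^ 2 + q * x + r|) Filter.atTop Filter.atTop := by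
  have hdeg : 0 < (C p * X ^ 2 + C q * X + C r).degree := by
    rw [← natDegree_pos_iff_degree_pos]
    rcases h with h | h
    · rw [natDegree_quadratic h]
      exact two_pos
    · exact le_natDegree_of_ne_zero (n := 1) (by simpa [coeff_X, coeff_C] using h)
  simpa using Polynomial.abs_tendsto_atTop _ hdeg

/-- Let `i ≠ j` with `M i j = 0` (an `∞`-edge). Then for every vector `v ∈ ℝ^n` not fixed by
both `σ_i` and `σ_j` (equivalently, `B(v, α_i) ≠ 0` or `B(v, α_j) ≠ 0`), the Euclidean norms
of the iterates `(σ_i σ_j)^k (v)` tend to infinity. -/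
theorem norm_iterate_tendsto_atTop {n : ℕ} (hn : 3 ≤ n) (M : CoxeterMatrix (Fin n))
    (i j : Fin n) (hij : i ≠ j) (hMij : M i j = 0)
    (v : EuclideanSpace ℝ (Fin n))
    (hv : bformE M v (simpleRootE i) ≠ 0 ∨ bformE M v (simpleRootE j) ≠ 0) :
    Filter.Tendsto
      (fun k : ℕ => ‖(fun u => simpleReflE M i (simpleReflE M j u))^[k] v‖)
      Filter.atTop Filter.atTop := by
  set a := bformE M v (simpleRootE i)
  set b := bformE M v (simpleRootE j)
  have hcoeff : -2 * (a + b) ≠ 0 ∨ 2 * (a + b) - 2 * b ≠ 0 := by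
    by_contra! h
    rcases hv with hv | hv
    · exact hv (by linarith)
    · exact hv (by linarith)
  refine Filter.tendsto_atTop_mono (fun k => ?_)
    ((tendsto_abs_quadratic_atTop (r := v j) hcoeff).comp tendsto_natCast_atTop_atTop)
  have hk := (iterate_simpleReflE_of_eq_zero M hij hMij v k).2.2
  refine le_trans (le_of_eq ?_) (PiLp.norm_apply_le _ j)
  rw [hk, Real.norm_eq_abs, Function.comp_apply]
  congr 1
  ring
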